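/- Let W(t) = (t+1)^{-1/2} and p = 1. Then the Garling function space G_{W,1}(0,∞) fails to admit an equivalent rearrangement-invariant norm: there do not exist constants 0 < c ≤ C < ∞ and a map ρ' from nonnegative measurable functions on (0,∞) to [0,∞] such that (i) ρ'(f) = ρ'(g) whenever f, g are equimeasurable functions with ρ_G(f) < ∞ and ρ_G(g) < ∞, and (ii) c·ρ_G(f) ≤ ρ'(f) ≤ C·ρ_G(f) for every measurable f : (0,∞) → [0,∞] with ρ_G(f) < ∞. -/

import Mathlib

open MeasureTheory Set ENNReal Filter

/-- An MO-isomorphism between subsets `E, F` of `ℝ`: a strictly increasing bijection from `E`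
onto `F` such that both it and its inverse are measure-preserving for Lebesgue measure. -/
structure MOIso (E F : Set ℝ) (m : ℝ → ℝ) : Prop where
  bijOn : Set.BijOn m E F
  strictMonoOn : StrictMonoOn m E
  measPres : ∀ A : Set ℝ, A ⊆ F → NullMeasurableSet A volume →
    NullMeasurableSet (E ∩ m ⁻¹' A) volume ∧ volume (E ∩ m ⁻¹' A) = volume A
  invMeasPres : ∀ B : Set ℝ, B ⊆ E → NullMeasurableSet B volume →
    NullMeasurableSet (m '' B) volume ∧ volume (m '' B) = volume B

/-- The class `𝕎` of weights: nonincreasing Lebesgue-measurable `W : (0,∞) → (0,∞)` with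
`W(t) → 0` as `t → ∞`, `∫_0^∞ W = ∞` and `∫_0^1 W < ∞`. -/
def memW (W : ℝ → ℝ) : Prop :=
  AntitoneOn W (Ioi 0) ∧ (∀ t ∈ Ioi (0:ℝ), 0 < W t) ∧ AEMeasurable W volume ∧
    Tendsto W atTop (nhds 0) ∧
    (∫⁻ t in Ioi (0:ℝ), ENNReal.ofReal (W t)) = ∞ ∧
    (∫⁻ t in Ioc (0:ℝ) 1, ENNReal.ofReal (W t)) < ∞

/-- The Garling function norm
`ρ_G(f) = sup over E, F ⊆ (0,∞) and MO-isomorphisms m : E → F of (∫_E f(m t)^p W(t) dt)^{1/p}`. -/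
noncomputable def rhoG (p : ℝ) (W : ℝ → ℝ) (f : ℝ → ℝ≥0∞) : ℝ≥0∞ :=
  ⨆ (E : Set ℝ) (F : Set ℝ) (m : ℝ → ℝ) (_ : E ⊆ Ioi 0) (_ : F ⊆ Ioi 0)
    (_ : NullMeasurableSet E volume) (_ : NullMeasurableSet F volume) (_ : MOIso E F m),
    (∫⁻ t in E, f (m t) ^ p * ENNReal.ofReal (W t)) ^ (1 / p)

theorem MOIso.measure_inter_preimage {E F : Set ℝ} {m : ℝ → ℝ} (hm : MOIso E F m)
    (hF : NullMeasurableSet F volume) {A : Set ℝ} (hA : MeasurableSet A) :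
    NullMeasurableSet (E ∩ m ⁻¹' A) volume ∧ volume (E ∩ m ⁻¹' A) = volume (F ∩ A) := by
  have h : E ∩ m ⁻¹' A = E ∩ m ⁻¹' (F ∩ A) := by
    ext t
    simp only [mem_inter_iff, mem_preimage]
    exact ⟨fun h => ⟨h.1, hm.bijOn.mapsTo h.1, h.2⟩, fun h => ⟨h.1, h.2.2⟩⟩
  rw [h]
  exact hm.measPres _ inter_subset_left (hF.inter hA.nullMeasurableSet)

theorem MOIso.aemeasurable {E F : Set ℝ} {m : ℝ → ℝ} (hm : MOIso E F m)
    (hE : NullMeasurableSet E volume) (hF : NullMeasurableSet F volume) :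
    AEMeasurable m (volume.restrict E) := by
  refine NullMeasurable.aemeasurable fun A hA => ?_
  rw [nullMeasurableSet_restrict hE, inter_comm]
  exact (hm.measure_inter_preimage hF hA).1

theorem MOIso.lintegral_comp {E F : Set ℝ} {m : ℝ → ℝ} (hm : MOIso E F m)
    (hE : NullMeasurableSet E volume) (hF : NullMeasurableSet F volume)
    {h : ℝ → ℝ≥0∞} (hh : Measurable h) :
    ∫⁻ t in E, h (m t) = ∫⁻ x in F, h x := by
  have hmap : Measure.map m (volume.restrict E) = volume.restrict F := by
    ext A hA
    rw [Measure.map_apply_of_aemeasurable (hm.aemeasurable hE hF) hA,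
      Measure.restrict_apply₀' hE, Measure.restrict_apply hA, inter_comm,
      (hm.measure_inter_preimage hF hA).2, inter_comm]
  rw [← hmap, lintegral_map' hh.aemeasurable (hm.aemeasurable hE hF)]

/-- The weight `(t + 1)^(-1/2)` with values in `[0, ∞]`. -/
noncomputable def garlingWeight (t : ℝ) : ℝ≥0∞ := ENNReal.ofReal ((t + 1) ^ (-(1 / 2) : ℝ))

theorem measurable_garlingWeight : Measurable garlingWeight := by
  unfold garlingWeight
  fun_prop

theorem garlingWeight_le {s t : ℝ} (hs : 0 ≤ s) (h : s ≤ t) :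
    garlingWeight t ≤ garlingWeight s :=
  ENNReal.ofReal_le_ofReal
    (Real.rpow_le_rpow_of_nonpos (by linarith) (by linarith) (by norm_num))

theorem garlingWeight_le_one {t : ℝ} (ht : 0 ≤ t) : garlingWeight t ≤ 1 := by
  simpa [garlingWeight] using garlingWeight_le le_rfl ht

theorem garlingWeight_eq {t : ℝ} (ht : 0 ≤ t) :
    garlingWeight t = ENNReal.ofReal (√(t + 1))⁻¹ := by
  rw [garlingWeight, Real.rpow_neg (by linarith), Real.sqrt_eq_rpow]

theorem lintegral_Ioc_garlingWeight_le {a : ℝ} (ha : 0 ≤ a) :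
    ∫⁻ t in Ioc 0 a, garlingWeight t ≤ ENNReal.ofReal (2 * √(a + 1)) := by
  have hcont : ContinuousOn (fun t : ℝ => (t + 1) ^ (-(1 / 2) : ℝ)) (uIcc 0 a) := by
    rw [uIcc_of_le ha]
    exact ContinuousOn.rpow_const (by fun_prop) fun t ht => Or.inl (by linarith [ht.1])
  have hint := hcont.intervalIntegrable (μ := volume)
  rw [intervalIntegrable_iff_integrableOn_Ioc_of_le ha] at hint
  unfold garlingWeight
  rw [← ofReal_integral_eq_lintegral_ofReal hint]
  · apply ENNReal.ofReal_le_ofReal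
    rw [← intervalIntegral.integral_of_le ha,
      intervalIntegral.integral_comp_add_right (fun t : ℝ => t ^ (-(1 / 2) : ℝ)),
      integral_rpow (Or.inl (by norm_num)), Real.sqrt_eq_rpow]
    norm_num
    linarith
  · filter_upwards [ae_restrict_mem measurableSet_Ioc] with t ht
    exact Real.rpow_nonneg (by linarith [ht.1]) _

theorem setLIntegral_garlingWeight_le {S : Set ℝ} (hS : NullMeasurableSet S volume)
    (hS0 : S ⊆ Ioi 0) {a : ℝ} (ha : 0 ≤ a) (hvol : volume S = ENNReal.ofReal a) :
    ∫⁻ t in S, garlingWeight t ≤ ENNReal.ofReal (3 * √(a + 1)) := by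
  have hpt : ∀ᵐ t ∂volume.restrict S,
      garlingWeight t ≤ (Ioc 0 a).indicator garlingWeight t + garlingWeight a := by
    filter_upwards [ae_restrict_mem₀ hS] with t ht
    rcases le_total t a with h | h
    · rw [indicator_of_mem (show t ∈ Ioc 0 a from ⟨hS0 ht, h⟩)]
      exact le_self_add
    · exact (garlingWeight_le ha h).trans le_add_self
  have hpos : 0 < √(a + 1) := Real.sqrt_pos.2 (by linarith)
  calc ∫⁻ t in S, garlingWeight t
      ≤ ∫⁻ t in S, ((Ioc 0 a).indicator garlingWeight t + garlingWeight a) :=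
        lintegral_mono_ae hpt
    _ = (∫⁻ t in S, (Ioc 0 a).indicator garlingWeight t) + garlingWeight a * volume S := by
        rw [lintegral_add_right _ measurable_const, setLIntegral_const]
    _ ≤ (∫⁻ t in Ioc 0 a, garlingWeight t) + garlingWeight a * volume S := by
        refine add_le_add_left ?_ _
        exact (setLIntegral_le_lintegral _ _).trans_eq (lintegral_indicator measurableSet_Ioc _)
    _ ≤ ENNReal.ofReal (2 * √(a + 1)) + ENNReal.ofReal (√(a + 1)) := by
        gcongr
        · exact lintegral_Ioc_garlingWeight_le ha
        · rw [hvol, garlingWeight_eq ha, ← ENNReal.ofReal_mul (by positivity)]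
          apply ENNReal.ofReal_le_ofReal
          rw [inv_mul_le_iff₀ hpos, Real.mul_self_sqrt (by linarith)]
          linarith
    _ = ENNReal.ofReal (3 * √(a + 1)) := by
        rw [← ENNReal.ofReal_add (by positivity) (by positivity)]
        ring_nf

/-- The truncation of the weight `(t + 1)^(-1/2)` to `(0, N)`. -/
noncomputable def truncWeight (N : ℝ) : ℝ → ℝ≥0∞ := (Ioo 0 N).indicator garlingWeight

theorem measurable_truncWeight (N : ℝ) : Measurable (truncWeight N) :=
  measurable_garlingWeight.indicator measurableSet_Ioo

theorem truncWeight_le_indicator_one (N t : ℝ) :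
    truncWeight N t ≤ (Ioo 0 N).indicator 1 t :=
  indicator_le_indicator' fun ht => garlingWeight_le_one ht.1.le

theorem truncWeight_eq_zero {N t : ℝ} (ht : t ∉ Ioo 0 N) : truncWeight N t = 0 :=
  indicator_of_notMem ht _

theorem sub_mem_Ioo_zero_iff {N x : ℝ} : N - x ∈ Ioo 0 N ↔ x ∈ Ioo 0 N := by
  simp only [mem_Ioo]
  constructor <;> rintro ⟨h1, h2⟩ <;> constructor <;> linarith

theorem rhoG_one_le {f : ℝ → ℝ≥0∞} {b : ℝ≥0∞}
    (h : ∀ (E F : Set ℝ) (m : ℝ → ℝ), E ⊆ Ioi 0 → F ⊆ Ioi 0 → NullMeasurableSet E volume →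
      NullMeasurableSet F volume → MOIso E F m → ∫⁻ t in E, f (m t) * garlingWeight t ≤ b) :
    rhoG 1 (fun t => (t + 1) ^ (-(1/2) : ℝ)) f ≤ b := by
  simp only [rhoG, iSup_le_iff]
  intro E F m hE0 hF0 hE hF hm
  simpa [garlingWeight] using h E F m hE0 hF0 hE hF hm

theorem rhoG_truncWeight_le (N : ℝ) :
    rhoG 1 (fun t => (t + 1) ^ (-(1/2) : ℝ)) (truncWeight N) ≤ ENNReal.ofReal N := by
  refine rhoG_one_le fun E F m hE0 hF0 hE hF hm => ?_
  calc ∫⁻ t in E, truncWeight N (m t) * garlingWeight t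
      ≤ ∫⁻ t in E, truncWeight N (m t) := by
        refine lintegral_mono_ae ?_
        filter_upwards [ae_restrict_mem₀ hE] with t ht
        exact mul_le_of_le_one_right' (garlingWeight_le_one (le_of_lt (hE0 ht)))
    _ = ∫⁻ x in F, truncWeight N x := hm.lintegral_comp hE hF (measurable_truncWeight N)
    _ ≤ ∫⁻ x, (Ioo 0 N).indicator 1 x :=
        (setLIntegral_le_lintegral _ _).trans
          (lintegral_mono (truncWeight_le_indicator_one N))
    _ = ENNReal.ofReal N := by
        rw [lintegral_indicator_one measurableSet_Ioo, Real.volume_Ioo, sub_zero]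

theorem moIso_id (S : Set ℝ) : MOIso S S id where
  bijOn := bijOn_id S
  strictMonoOn := strictMono_id.strictMonoOn S
  measPres A hA h := by simpa [inter_eq_right.2 hA] using h
  invMeasPres B _ h := by simpa using h

theorem log_le_rhoG_truncWeight {N : ℝ} (hN : 0 ≤ N) :
    ENNReal.ofReal (Real.log (N + 1)) ≤
      rhoG 1 (fun t => (t + 1) ^ (-(1/2) : ℝ)) (truncWeight N) := by
  have key : ENNReal.ofReal (Real.log (N + 1)) =
      ∫⁻ t in Ioo 0 N, truncWeight N t * garlingWeight t := by
    have hcont : ContinuousOn (fun t : ℝ => (t + 1)⁻¹) (uIcc 0 N) := by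
      rw [uIcc_of_le hN]
      exact ContinuousOn.inv₀ (by fun_prop) fun t ht => by linarith [ht.1]
    have hint := hcont.intervalIntegrable (μ := volume)
    rw [intervalIntegrable_iff_integrableOn_Ioo_of_le hN] at hint
    have hI : ∫ t in Ioo 0 N, (t + 1)⁻¹ = Real.log (N + 1) := by
      rw [← integral_Ioc_eq_integral_Ioo, ← intervalIntegral.integral_of_le hN,
        intervalIntegral.integral_comp_add_right (fun t : ℝ => t⁻¹),
        integral_inv_of_pos (by norm_num) (by linarith)]
      simp
    rw [← hI, ofReal_integral_eq_lintegral_ofReal hint]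
    · refine setLIntegral_congr_fun measurableSet_Ioo fun t ht => ?_
      have h0 : 0 ≤ t := ht.1.le
      simp only [truncWeight, indicator_of_mem ht]
      rw [garlingWeight_eq h0, ← ENNReal.ofReal_mul (by positivity), ← mul_inv,
        Real.mul_self_sqrt (by linarith)]
    · filter_upwards [ae_restrict_mem measurableSet_Ioo] with t ht
      exact inv_nonneg.2 (by linarith [ht.1])
  have hsub : Ioo 0 N ⊆ Ioi 0 := fun t ht => ht.1
  have hmeas : NullMeasurableSet (Ioo 0 N) volume := measurableSet_Ioo.nullMeasurableSet
  rw [key, rhoG]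
  refine le_iSup_of_le (Ioo 0 N) <| le_iSup_of_le (Ioo 0 N) <| le_iSup_of_le id <|
    le_iSup_of_le hsub <| le_iSup_of_le hsub <| le_iSup_of_le hmeas <| le_iSup_of_le hmeas <|
    le_iSup_of_le (moIso_id _) ?_
  simp [garlingWeight]

theorem setLIntegral_truncWeight_sub_le {N : ℝ} {F : Set ℝ} (hF : NullMeasurableSet F volume)
    {a : ℝ} (ha : 0 ≤ a) (hvol : volume (F ∩ Ioo 0 N) = ENNReal.ofReal a) :
    ∫⁻ x in F, truncWeight N (N - x) ≤ ENNReal.ofReal (3 * √(a + 1)) := by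
  have hmp : MeasurePreserving (fun x : ℝ => N - x) volume volume :=
    Measure.measurePreserving_sub_left volume N
  have hF' : NullMeasurableSet (F ∩ Ioo 0 N) volume := hF.inter measurableSet_Ioo.nullMeasurableSet
  have hS : NullMeasurableSet ((fun x : ℝ => N - x) ⁻¹' (F ∩ Ioo 0 N)) volume :=
    hF'.preimage hmp.quasiMeasurePreserving
  calc ∫⁻ x in F, truncWeight N (N - x)
      = ∫⁻ x, F.indicator (fun x => truncWeight N (N - x)) x :=
        (lintegral_indicator₀ hF _).symm
    _ = ∫⁻ x, F.indicator (fun x => truncWeight N (N - x)) (N - x) := by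
        rw [lintegral_sub_left_eq_self]
    _ = ∫⁻ x in (fun x : ℝ => N - x) ⁻¹' (F ∩ Ioo 0 N), garlingWeight x := by
        rw [← lintegral_indicator₀ hS]
        congr 1 with x
        by_cases hxF : N - x ∈ F <;> by_cases hx : x ∈ Ioo 0 N <;>
          simp [indicator, truncWeight, hxF, hx, -mem_Ioo]
    _ ≤ ENNReal.ofReal (3 * √(a + 1)) := by
        refine setLIntegral_garlingWeight_le hS (fun x hx => ?_) ha ?_
        · exact (sub_mem_Ioo_zero_iff.1 hx.2).1
        · rw [hmp.measure_preimage hF', hvol]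

/-- A point in the first half of the part of `E` that `m` maps into `(0, N)` has its image far
from `N`. -/
theorem MOIso.half_le_sub {E F : Set ℝ} {m : ℝ → ℝ} (hm : MOIso E F m) (hE0 : E ⊆ Ioi 0)
    {N a t : ℝ} (hE : NullMeasurableSet (E ∩ m ⁻¹' Ioo 0 N) volume)
    (hvol : volume (E ∩ m ⁻¹' Ioo 0 N) = ENNReal.ofReal a) (ht : t ∈ E ∩ m ⁻¹' Ioo 0 N)
    (hta : t ≤ a / 2) : a / 2 ≤ N - m t := by
  set E' := E ∩ m ⁻¹' Ioo 0 N
  have ht0 : 0 < t := hE0 ht.1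
  have hright : volume (E' ∩ Ioi t) ≤ ENNReal.ofReal (N - m t) := by
    have hB : E' ∩ Ioi t ⊆ E := fun x hx => hx.1.1
    rw [← (hm.invMeasPres _ hB (hE.inter measurableSet_Ioi.nullMeasurableSet)).2,
      ← Real.volume_Ioo]
    refine measure_mono ?_
    rintro _ ⟨x, hx, rfl⟩
    exact ⟨hm.strictMonoOn ht.1 hx.1.1 hx.2, hx.1.2.2⟩
  have hleft : volume (E' ∩ Iic t) ≤ ENNReal.ofReal t := by
    calc volume (E' ∩ Iic t) ≤ volume (Ioc 0 t) :=
          measure_mono fun x hx => ⟨hE0 hx.1.1, hx.2⟩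
      _ = ENNReal.ofReal t := by rw [Real.volume_Ioc, sub_zero]
  have hsum : ENNReal.ofReal a ≤ ENNReal.ofReal (t + (N - m t)) := by
    rw [← hvol, ENNReal.ofReal_add ht0.le (by linarith [ht.2.2])]
    calc volume E' ≤ volume (E' ∩ Iic t) + volume (E' ∩ Ioi t) := by
          refine (measure_mono fun x hx => ?_).trans (measure_union_le _ _)
          rcases le_or_gt x t with h | h
          · exact Or.inl ⟨hx, h⟩
          · exact Or.inr ⟨hx, h⟩
      _ ≤ _ := add_le_add hleft hright
  have := (ENNReal.ofReal_le_ofReal_iff (by linarith [ht.2.2])).1 hsum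
  linarith

theorem rhoG_truncWeight_sub_le (N : ℝ) :
    rhoG 1 (fun t => (t + 1) ^ (-(1/2) : ℝ)) (fun x => truncWeight N (N - x)) ≤
      ENNReal.ofReal 12 := by
  refine rhoG_one_le fun E F m hE0 hF0 hE hF hm => ?_
  obtain ⟨hE', hvolE'⟩ := hm.measure_inter_preimage hF (measurableSet_Ioo (a := 0) (b := N))
  set E' := E ∩ m ⁻¹' Ioo 0 N
  have hfin : volume (F ∩ Ioo 0 N) ≠ ∞ :=
    ((measure_mono inter_subset_right).trans_lt measure_Ioo_lt_top).ne
  obtain ⟨a, ha, hvol⟩ : ∃ a : ℝ, 0 ≤ a ∧ volume (F ∩ Ioo 0 N) = ENNReal.ofReal a :=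
    ⟨_, ENNReal.toReal_nonneg, (ENNReal.ofReal_toReal hfin).symm⟩
  rw [hvol] at hvolE'
  have ha2 : 0 ≤ a / 2 := by linarith
  have hpt : ∀ᵐ t ∂volume.restrict E, truncWeight N (N - m t) * garlingWeight t ≤
      garlingWeight (a / 2) * (E'.indicator garlingWeight t + truncWeight N (N - m t)) := by
    filter_upwards [ae_restrict_mem₀ hE] with t ht
    by_cases hmt : m t ∈ Ioo 0 N
    · have htE' : t ∈ E' := ⟨ht, hmt⟩
      rw [indicator_of_mem htE', mul_add]
      rcases le_total t (a / 2) with h | h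
      · refine le_trans ?_ le_self_add
        gcongr
        rw [truncWeight, indicator_of_mem (sub_mem_Ioo_zero_iff.2 hmt)]
        exact garlingWeight_le ha2 (hm.half_le_sub hE0 hE' hvolE' htE' h)
      · refine le_trans ?_ le_add_self
        rw [mul_comm]
        gcongr
        exact garlingWeight_le ha2 h
    · rw [truncWeight_eq_zero (mt sub_mem_Ioo_zero_iff.1 hmt), zero_mul]
      exact zero_le
  calc ∫⁻ t in E, truncWeight N (N - m t) * garlingWeight t
      ≤ ∫⁻ t in E, garlingWeight (a / 2) *
          (E'.indicator garlingWeight t + truncWeight N (N - m t)) := lintegral_mono_ae hpt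
    _ = garlingWeight (a / 2) * ((∫⁻ t in E, E'.indicator garlingWeight t) +
          ∫⁻ t in E, truncWeight N (N - m t)) := by
        rw [lintegral_const_mul' (garlingWeight (a / 2)) _ ENNReal.ofReal_ne_top, lintegral_add_left']
        exact (measurable_garlingWeight.aemeasurable.indicator₀ hE').restrict
    _ ≤ garlingWeight (a / 2) *
          (ENNReal.ofReal (3 * √(a + 1)) + ENNReal.ofReal (3 * √(a + 1))) := by
        gcongr
        · refine (setLIntegral_le_lintegral _ _).trans ?_
          rw [lintegral_indicator₀ hE']
          exact setLIntegral_garlingWeight_le hE' (fun x hx => hE0 hx.1) ha hvolE'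
        · rw [hm.lintegral_comp (h := fun x => truncWeight N (N - x)) hE hF
            ((measurable_truncWeight N).comp (by fun_prop))]
          exact setLIntegral_truncWeight_sub_le hF ha hvol
    _ ≤ ENNReal.ofReal 12 := by
        have hpos : 0 < √(a / 2 + 1) := Real.sqrt_pos.2 (by linarith)
        have hle : √(a + 1) ≤ 2 * √(a / 2 + 1) := by
          rw [Real.sqrt_le_left (by positivity), mul_pow, Real.sq_sqrt (by linarith)]
          linarith
        rw [garlingWeight_eq ha2, ← ENNReal.ofReal_add (by positivity) (by positivity),
          ← ENNReal.ofReal_mul (by positivity)]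
        apply ENNReal.ofReal_le_ofReal
        rw [inv_mul_le_iff₀ hpos]
        linarith

theorem volume_lt_truncWeight_eq (N : ℝ) (s : ℝ≥0∞) :
    volume {t ∈ Ioi (0:ℝ) | s < truncWeight N t} =
      volume {t ∈ Ioi (0:ℝ) | s < truncWeight N (N - t)} := by
  have hf : {t ∈ Ioi (0:ℝ) | s < truncWeight N t} = {t | s < truncWeight N t} := by
    refine Set.ext fun t => and_iff_right_of_imp fun h => ?_
    by_contra ht
    rw [truncWeight_eq_zero fun h' => ht h'.1] at h
    exact _root_.not_lt_zero h
  have hg : {t ∈ Ioi (0:ℝ) | s < truncWeight N (N - t)} =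
      (fun t => N - t) ⁻¹' {t | s < truncWeight N t} := by
    refine Set.ext fun t => and_iff_right_of_imp fun h => ?_
    by_contra ht
    rw [truncWeight_eq_zero fun h' => ht (sub_mem_Ioo_zero_iff.1 h').1] at h
    exact _root_.not_lt_zero h
  rw [hf, hg, (Measure.measurePreserving_sub_left volume N).measure_preimage
    (measurableSet_lt measurable_const (measurable_truncWeight N)).nullMeasurableSet]

/-- With `W(t) = (t+1)^{-1/2}` and `p = 1`, the Garling function space
`G_{W,1}(0,∞)` admits no equivalent rearrangement-invariant norm. -/
theorem stmt8 :
    ¬ ∃ (c C : ℝ) (ρ' : (ℝ → ℝ≥0∞) → ℝ≥0∞), 0 < c ∧ c ≤ C ∧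
      -- (i) ρ' is rearrangement-invariant on the Garling function space
      (∀ f g : ℝ → ℝ≥0∞, Measurable f → Measurable g →
        rhoG 1 (fun t => (t + 1) ^ (-(1/2) : ℝ)) f < ∞ →
        rhoG 1 (fun t => (t + 1) ^ (-(1/2) : ℝ)) g < ∞ →
        (∀ s : ℝ≥0∞, volume {t ∈ Ioi (0:ℝ) | s < f t} = volume {t ∈ Ioi (0:ℝ) | s < g t}) →
        ρ' f = ρ' g) ∧
      -- (ii) ρ' is equivalent to ρ_G
      (∀ f : ℝ → ℝ≥0∞, Measurable f → rhoG 1 (fun t => (t + 1) ^ (-(1/2) : ℝ)) f < ∞ →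
        ENNReal.ofReal c * rhoG 1 (fun t => (t + 1) ^ (-(1/2) : ℝ)) f ≤ ρ' f ∧
        ρ' f ≤ ENNReal.ofReal C * rhoG 1 (fun t => (t + 1) ^ (-(1/2) : ℝ)) f) := by
  rintro ⟨c, C, ρ', hc, hcC, hri, heq⟩
  have hC : 0 < C := hc.trans_le hcC
  set L : ℝ := 12 * C / c + 1
  have hL : 0 < L := by positivity
  set N : ℝ := Real.exp L - 1 with hN
  have hN0 : 0 ≤ N := by linarith [Real.add_one_le_exp L]
  have hlog : Real.log (N + 1) = L := by simp [hN]
  have hmf := measurable_truncWeight N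
  have hmg : Measurable fun x => truncWeight N (N - x) := hmf.comp (by fun_prop)
  have hf := (rhoG_truncWeight_le N).trans_lt ENNReal.ofReal_lt_top
  have hg := (rhoG_truncWeight_sub_le N).trans_lt ENNReal.ofReal_lt_top
  have hρ := hri _ _ hmf hmg hf hg (volume_lt_truncWeight_eq N)
  have h : ENNReal.ofReal (c * L) ≤ ENNReal.ofReal (C * 12) := by
    rw [ENNReal.ofReal_mul hc.le, ENNReal.ofReal_mul hC.le, ← hlog]
    calc _ ≤ _ := mul_le_mul_right (log_le_rhoG_truncWeight hN0) _
      _ ≤ _ := (heq _ hmf hf).1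
      _ = _ := hρ
      _ ≤ _ := (heq _ hmg hg).2
      _ ≤ _ := mul_le_mul_right (rhoG_truncWeight_sub_le N) _
  have h' := (ENNReal.ofReal_le_ofReal_iff (by positivity)).1 h
  have hcL : c * L = 12 * C + c := by
    simp only [L]
    field_simp
  linarith
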